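/- Consider the semidiscrete SD-RT(1) scheme on the right-triangular mesh for the transport equation with transport velocity ω = (ω_x, ω_y) satisfying ω_x > 0 and ω_y = 0 (the velocity is parallel to a family of mesh edges). Then the optimal order of accuracy of the scheme is 1: the scheme has order 1, but it does not have order 2. -/

import Mathlib

open Matrix

noncomputable section

/-- Coefficient matrix `L^x_{(0,0)}` of the SD-RT(1) scheme. -/
def Lx00 : Matrix (Fin 6) (Fin 6) ℝ :=
  !![3,1,1,0,0,0; -3,1,-2,0,0,0; 0,1,4,0,0,0;
     0,-1,-4,3,1,1; 0,2,2,-3,1,-2; 0,-4,-1,0,1,4]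

/-- Coefficient matrix `L^x_{(-1,0)}` of the SD-RT(1) scheme. -/
def Lxm : Matrix (Fin 6) (Fin 6) ℝ :=
  !![0,0,0,0,-1,-4; 0,0,0,0,2,2; 0,0,0,0,-4,-1;
     0,0,0,0,0,0; 0,0,0,0,0,0; 0,0,0,0,0,0]

/-- Coefficient matrix `L^y_{(0,0)}` of the SD-RT(1) scheme. -/
def Ly00 : Matrix (Fin 6) (Fin 6) ℝ :=
  !![3,1,1,0,0,0; 0,4,1,0,0,0; -3,-2,1,0,0,0;
     0,-1,-4,4,1,0; 0,2,2,-2,1,-3; 0,-4,-1,1,1,3]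

/-- Coefficient matrix `L^y_{(0,-1)}` of the SD-RT(1) scheme. -/
def Lym : Matrix (Fin 6) (Fin 6) ℝ :=
  !![0,0,0,-4,-1,0; 0,0,0,-1,-4,0; 0,0,0,2,2,0;
     0,0,0,0,0,0; 0,0,0,0,0,0; 0,0,0,0,0,0]

/-- `L_{(0,0)} = ω_x · Lx00 + ω_y · Ly00`. -/
def L00 (ω : ℝ × ℝ) : Matrix (Fin 6) (Fin 6) ℝ := ω.1 • Lx00 + ω.2 • Ly00

/-- `L_{(-1,0)} = ω_x · Lxm`. -/
def Lm0 (ω : ℝ × ℝ) : Matrix (Fin 6) (Fin 6) ℝ := ω.1 • Lxm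

/-- `L_{(0,-1)} = ω_y · Lym`. -/
def L0m (ω : ℝ × ℝ) : Matrix (Fin 6) (Fin 6) ℝ := ω.2 • Lym

/-- `L(0) = L_{(0,0)} + L_{(-1,0)} + L_{(0,-1)}`. -/
def Lzero (ω : ℝ × ℝ) : Matrix (Fin 6) (Fin 6) ℝ := L00 ω + Lm0 ω + L0m ω

/-- Solution points `a_1,…,a_6` of the reference block. -/
def apt : Fin 6 → ℝ × ℝ := ![(0,0), (1,0), (0,1), (0,1), (1,1), (1,0)]

/-- A mesh function on the periodic mesh with `N × N` blocks. -/
abbrev Mesh (N : ℕ) := (ZMod N × ZMod N) → (Fin 6 → ℝ)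

/-- The norm `‖u‖² = Σ_η h² |u_η|²` with `h = 1/N` (Euclidean norm on `ℝ^6`). -/
def meshNorm (N : ℕ) [NeZero N] (u : Mesh N) : ℝ :=
  Real.sqrt (∑ η : ZMod N × ZMod N, ((1 : ℝ) / N) ^ 2 * ∑ ξ : Fin 6, (u η ξ) ^ 2)

/-- The Lagrangian mapping `Π_h`, `h = 1/N`: `(Π_h v)_{η,ξ} = v((η + a_ξ)h)`. -/
def Pih (N : ℕ) [NeZero N] (v : ℝ × ℝ → ℝ) : Mesh N :=
  fun η ξ => v ((((η.1.val : ℝ) + (apt ξ).1) / N, ((η.2.val : ℝ) + (apt ξ).2) / N))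

/-- 1-periodicity in both variables. -/
def Periodic2 (v : ℝ × ℝ → ℝ) : Prop :=
  (∀ x y : ℝ, v (x + 1, y) = v (x, y)) ∧ (∀ x y : ℝ, v (x, y + 1) = v (x, y))

/-- `u : ℝ → Mesh N` solves the semidiscrete SD-RT(1) scheme
`du_η/dt + (1/h) Σ_{ζ∈S} L_ζ u_{η+ζ} = 0`, `h = 1/N`. -/
def IsSol (ω : ℝ × ℝ) (N : ℕ) [NeZero N] (u : ℝ → Mesh N) : Prop :=
  ∀ (η : ZMod N × ZMod N) (t : ℝ),
    HasDerivAt (fun s => u s η)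
      (-((N : ℝ) • (L00 ω *ᵥ u t η + Lm0 ω *ᵥ u t (η + (-1, 0))
          + L0m ω *ᵥ u t (η + (0, -1))))) t

/-- The scheme has order `q`: for every 1-periodic `v0 ∈ C^{q+1}` the solution error
satisfies `‖ε_h(t,v0)‖ ≤ (c1 + c2 t) h^q` for all `N` and `t ≥ 0`. -/
def HasOrder (ω : ℝ × ℝ) (q : ℕ) : Prop :=
  ∀ v0 : ℝ × ℝ → ℝ, Periodic2 v0 → ContDiff ℝ (q + 1 : ℕ) v0 →
    ∃ c1 c2 : ℝ, 0 ≤ c1 ∧ 0 ≤ c2 ∧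
      ∀ (N : ℕ) [NeZero N], ∀ u : ℝ → Mesh N, IsSol ω N u → u 0 = Pih N v0 →
        ∀ t : ℝ, 0 ≤ t →
          meshNorm N (u t - Pih N (fun r => v0 (r - t • ω)))
            ≤ (c1 + c2 * t) * ((1 : ℝ) / N) ^ q

/-! ### Regularity of periodic functions -/

lemma Periodic2.add_int {v : ℝ × ℝ → ℝ} (hv : Periodic2 v) (k : ℤ) (x y : ℝ) :
    v (x + k, y) = v (x, y) := by
  have h : Function.Periodic (fun x => v (x, y)) 1 := fun x => hv.1 x y
  simpa using h.int_mul k x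

lemma fderiv_periodic {E F : Type*} [NormedAddCommGroup E] [NormedSpace ℝ E]
    [NormedAddCommGroup F] [NormedSpace ℝ F] {f : E → F} {c : E} (hf : Function.Periodic f c) :
    Function.Periodic (fderiv ℝ f) c := by
  intro x
  rw [← fderiv_comp_add_right]
  exact congrArg (fun g => fderiv ℝ g x) (funext hf)

lemma exists_norm_le_of_periodic {F : Type*} [NormedAddCommGroup F] {g : ℝ × ℝ → F}
    (hg : Continuous g) (h1 : Function.Periodic g (1, 0)) (h2 : Function.Periodic g (0, 1)) :
    ∃ M : ℝ, ∀ p, ‖g p‖ ≤ M := by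
  obtain ⟨M, hM⟩ := ((isCompact_Icc (a := (0 : ℝ)) (b := 1)).prod
    (isCompact_Icc (a := (0 : ℝ)) (b := 1))).exists_bound_of_continuousOn hg.continuousOn
  refine ⟨M, fun p => ?_⟩
  have e : g p = g (Int.fract p.1, Int.fract p.2) := by
    have e1 := h1.sub_zsmul_eq (x := p) ⌊p.1⌋
    have e2 := h2.sub_zsmul_eq (x := p - ⌊p.1⌋ • ((1, 0) : ℝ × ℝ)) ⌊p.2⌋
    rw [← e1, ← e2]
    congr 1
    ext <;> simp [Int.self_sub_floor]
  rw [e]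
  exact hM _ ⟨⟨Int.fract_nonneg _, (Int.fract_lt_one _).le⟩,
    ⟨Int.fract_nonneg _, (Int.fract_lt_one _).le⟩⟩

lemma Periodic2.exists_lipschitz_fderiv {v : ℝ × ℝ → ℝ} (hv : Periodic2 v)
    (hc : ContDiff ℝ 2 v) :
    ∃ M : ℝ, 0 ≤ M ∧ ∀ p q, ‖fderiv ℝ v p - fderiv ℝ v q‖ ≤ M * ‖p - q‖ := by
  have h1 : Function.Periodic v (1, 0) := fun p => by
    rw [← hv.1 p.1 p.2]; congr 1; ext <;> simp
  have h2 : Function.Periodic v (0, 1) := fun p => by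
    rw [← hv.2 p.1 p.2]; congr 1; ext <;> simp
  have hF : ContDiff ℝ 1 (fderiv ℝ v) := hc.fderiv_right (by norm_num)
  obtain ⟨M, hM⟩ := exists_norm_le_of_periodic (hF.continuous_fderiv (by norm_num))
    (fderiv_periodic (fderiv_periodic h1)) (fderiv_periodic (fderiv_periodic h2))
  refine ⟨M, (norm_nonneg _).trans (hM 0), fun p q => ?_⟩
  exact convex_univ.norm_image_sub_le_of_norm_fderiv_le
    (fun x _ => (hF.differentiable (by norm_num)).differentiableAt) (fun x _ => hM x)
    (Set.mem_univ q) (Set.mem_univ p)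

lemma abs_taylor_remainder_le {v : ℝ × ℝ → ℝ} {M : ℝ} (hM : 0 ≤ M) (hd : Differentiable ℝ v)
    (hL : ∀ p q, ‖fderiv ℝ v p - fderiv ℝ v q‖ ≤ M * ‖p - q‖) (r d : ℝ × ℝ) :
    |v (r + d) - v r - fderiv ℝ v r d| ≤ M * ‖d‖ ^ 2 := by
  have key := (convex_closedBall r ‖d‖).norm_image_sub_le_of_norm_fderiv_le' (𝕜 := ℝ) (f := v)
    (φ := fderiv ℝ v r) (C := M * ‖d‖) (x := r) (y := r + d)
    (fun x _ => hd.differentiableAt) (fun x hx => (hL x r).trans ?_) (by simp) (by simp)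
  · rw [Real.norm_eq_abs, add_sub_cancel_left] at key
    nlinarith [key]
  · rw [mem_closedBall_iff_norm] at hx
    gcongr

/-! ### Values of mesh projections at neighbouring blocks -/

lemma ZMod.exists_val_sub_one (N : ℕ) [NeZero N] (m : ZMod N) :
    ∃ k : ℤ, ((m + -1).val : ℤ) = m.val - 1 + N * k := by
  have h : (((m + -1).val : ℤ) : ZMod N) = ((m.val - 1 : ℤ) : ZMod N) := by
    push_cast
    simp [sub_eq_add_neg]
  obtain ⟨k, hk⟩ := (ZMod.intCast_eq_intCast_iff_dvd_sub _ _ _).1 h.symm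
  exact ⟨k, by linarith⟩

lemma Pih_left {N : ℕ} [NeZero N] {v : ℝ × ℝ → ℝ} (hv : Periodic2 v) (η : ZMod N × ZMod N)
    (ξ : Fin 6) :
    Pih N v (η + (-1, 0)) ξ =
      v (((η.1.val : ℝ) - 1 + (apt ξ).1) / N, ((η.2.val : ℝ) + (apt ξ).2) / N) := by
  obtain ⟨k, hk⟩ := ZMod.exists_val_sub_one N η.1
  have hk' : (((η.1 + -1).val : ℕ) : ℝ) = η.1.val - 1 + N * k := by exact_mod_cast hk
  have hN : (N : ℝ) ≠ 0 := Nat.cast_ne_zero.2 (NeZero.ne N)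
  rw [← hv.add_int k]
  simp only [Pih, Prod.fst_add, Prod.snd_add, add_zero]
  rw [hk']
  congr 2
  field_simp
  ring

/-! ### The discrete energy -/

/-- The bilinear form of the energy in which the scheme is dissipative. -/
def energyForm (w z : Fin 6 → ℝ) : ℝ :=
  3 * (w 0 * z 0 + w 1 * z 1 + w 2 * z 2 + w 3 * z 3 + w 4 * z 4 + w 5 * z 5)
    + 2 * (w 0 + w 1 + w 2) * (z 0 + z 1 + z 2) + 2 * (w 3 + w 4 + w 5) * (z 3 + z 4 + z 5)

/-- The energy flux through the right edge of a block. -/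
def energyFlux (w : Fin 6 → ℝ) : ℝ := 18 * (w 4 ^ 2 + w 4 * w 5 + w 5 ^ 2)

lemma energyFlux_sub_le (w z : Fin 6 → ℝ) :
    energyFlux w - energyFlux z ≤ 2 * energyForm w (Lx00 *ᵥ w + Lxm *ᵥ z) := by
  have h : 2 * energyForm w (Lx00 *ᵥ w + Lxm *ᵥ z) = energyFlux w - energyFlux z
      + 18 * ((w 0 - z 5) ^ 2 + (w 0 - z 5) * (w 2 - z 4) + (w 2 - z 4) ^ 2)
      + 18 * ((w 3 - w 2) ^ 2 + (w 3 - w 2) * (w 5 - w 1) + (w 5 - w 1) ^ 2) := by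
    simp [energyForm, energyFlux, Lx00, Lxm, dotProduct, Fin.sum_univ_six]
    ring
  have q : ∀ x y : ℝ, 0 ≤ x ^ 2 + x * y + y ^ 2 := fun x y => by
    nlinarith [sq_nonneg (x + y), sq_nonneg x, sq_nonneg y]
  rw [h]
  linarith [q (w 0 - z 5) (w 2 - z 4), q (w 3 - w 2) (w 5 - w 1)]

lemma energyForm_self_nonneg (w : Fin 6 → ℝ) : 0 ≤ energyForm w w := by
  unfold energyForm
  nlinarith [sq_nonneg (w 0), sq_nonneg (w 1), sq_nonneg (w 2), sq_nonneg (w 3), sq_nonneg (w 4),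
    sq_nonneg (w 5), sq_nonneg (w 0 + w 1 + w 2), sq_nonneg (w 3 + w 4 + w 5)]

lemma sum_sq_le_energyForm (w : Fin 6 → ℝ) : ∑ ξ, w ξ ^ 2 ≤ energyForm w w := by
  rw [Fin.sum_univ_six]
  unfold energyForm
  nlinarith [sq_nonneg (w 0), sq_nonneg (w 1), sq_nonneg (w 2), sq_nonneg (w 3), sq_nonneg (w 4),
    sq_nonneg (w 5), sq_nonneg (w 0 + w 1 + w 2), sq_nonneg (w 3 + w 4 + w 5)]

lemma energyForm_self_le {w : Fin 6 → ℝ} {B : ℝ} (hB : ∀ ξ, |w ξ| ≤ B) :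
    energyForm w w ≤ 54 * B ^ 2 := by
  have h : ∀ ξ, w ξ ^ 2 ≤ B ^ 2 := fun ξ => sq_le_sq.2 ((hB ξ).trans (le_abs_self B))
  unfold energyForm
  nlinarith [h 0, h 1, h 2, h 3, h 4, h 5, sq_nonneg (w 0 - w 1), sq_nonneg (w 0 - w 2),
    sq_nonneg (w 1 - w 2), sq_nonneg (w 3 - w 4), sq_nonneg (w 3 - w 5), sq_nonneg (w 4 - w 5)]

lemma two_mul_energyForm_le (w z : Fin 6 → ℝ) {a : ℝ} (ha : 0 < a) :
    2 * energyForm w z ≤ a * energyForm w w + a⁻¹ * energyForm z z := by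
  have h := energyForm_self_nonneg (fun ξ => a * w ξ - z ξ)
  have e : energyForm (fun ξ => a * w ξ - z ξ) (fun ξ => a * w ξ - z ξ) =
      a * (a * energyForm w w + a⁻¹ * energyForm z z - 2 * energyForm w z) := by
    unfold energyForm
    field_simp
    ring
  rw [e] at h
  linarith [nonneg_of_mul_nonneg_right h ha]

lemma HasDerivAt.energyForm_self {w : ℝ → Fin 6 → ℝ} {w' : Fin 6 → ℝ} {t : ℝ}
    (h : HasDerivAt w w' t) :
    HasDerivAt (fun s => energyForm (w s) (w s)) (2 * energyForm (w t) w') t := by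
  have h := hasDerivAt_pi.1 h
  have key := (((((((((h 0).mul (h 0)).add ((h 1).mul (h 1))).add ((h 2).mul (h 2))).add
    ((h 3).mul (h 3))).add ((h 4).mul (h 4))).add ((h 5).mul (h 5))).const_mul 3).add
    (((((h 0).add (h 1)).add (h 2)).const_mul 2).mul (((h 0).add (h 1)).add (h 2)))).add
    (((((h 3).add (h 4)).add (h 5)).const_mul 2).mul (((h 3).add (h 4)).add (h 5)))
  refine key.congr_deriv ?_
  simp only [energyForm, Pi.add_apply]
  ring

/-! ### Consistency and convergence -/

/-- The local truncation error of the scheme for the velocity `(a, 0)` at the block `η`. -/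
def truncation (a : ℝ) (N : ℕ) [NeZero N] (v : ℝ × ℝ → ℝ) (η : ZMod N × ZMod N) : Fin 6 → ℝ :=
  fun ξ => a * (Pih N (fun r => fderiv ℝ v r (1, 0)) η ξ
    - N * (Lx00 *ᵥ Pih N v η + Lxm *ᵥ Pih N v (η + (-1, 0))) ξ)

lemma abs_truncation_le {a M : ℝ} (ha : 0 ≤ a) (hM : 0 ≤ M) (N : ℕ) [NeZero N] {v : ℝ × ℝ → ℝ}
    (hv : Periodic2 v) (hd : Differentiable ℝ v)
    (hL : ∀ p q, ‖fderiv ℝ v p - fderiv ℝ v q‖ ≤ M * ‖p - q‖) (η : ZMod N × ZMod N) (ξ : Fin 6) :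
    |truncation a N v η ξ| ≤ 30 * a * M / N := by
  have hN : (0 : ℝ) < N := Nat.cast_pos.2 (NeZero.pos N)
  set r : ℝ × ℝ := ((η.1.val : ℝ) / N, (η.2.val : ℝ) / N) with hr
  set A := fderiv ℝ v r (1, 0) with hA
  set B := fderiv ℝ v r (0, 1)
  have hlin : ∀ b c : ℝ, fderiv ℝ v r (b / N, c / N) = (b * A + c * B) / N := by
    intro b c
    have : ((b / N, c / N) : ℝ × ℝ) = (b / N) • (1, 0) + (c / N) • (0, 1) := by simp
    rw [this, map_add, map_smul, map_smul, smul_eq_mul, smul_eq_mul]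
    ring
  have hnorm : ∀ b c : ℝ, |b| ≤ 1 → |c| ≤ 1 → ‖((b / N, c / N) : ℝ × ℝ)‖ ≤ 1 / N := by
    intro b c hb hc
    rw [Prod.norm_def]
    simp only [Real.norm_eq_abs, abs_div, abs_of_pos hN]
    exact max_le (by gcongr) (by gcongr)
  have hval : ∀ b c : ℝ, |b| ≤ 1 → |c| ≤ 1 → ∃ R : ℝ, |R| ≤ M ∧
      v ((η.1.val + b) / N, (η.2.val + c) / N) = v r + (b * A + c * B) / N + R / N ^ 2 := by
    intro b c hb hc
    have h := abs_taylor_remainder_le hM hd hL r (b / N, c / N)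
    have e : r + (b / N, c / N) = ((η.1.val + b) / N, (η.2.val + c) / N) := by
      simp [hr, add_div]
    rw [e, hlin] at h
    refine ⟨(v ((η.1.val + b) / N, (η.2.val + c) / N) - v r - (b * A + c * B) / N) * N ^ 2,
      ?_, by field_simp; ring⟩
    rw [abs_mul, abs_of_pos (by positivity : (0 : ℝ) < N ^ 2), ← le_div_iff₀ (by positivity)]
    refine h.trans ?_
    have := hnorm b c hb hc
    calc M * ‖((b / N, c / N) : ℝ × ℝ)‖ ^ 2 ≤ M * (1 / N) ^ 2 := by gcongr
      _ = M / N ^ 2 := by field_simp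
  have hder : ∀ b c : ℝ, |b| ≤ 1 → |c| ≤ 1 → ∃ S : ℝ, |S| ≤ M ∧
      fderiv ℝ v ((η.1.val + b) / N, (η.2.val + c) / N) (1, 0) = A + S / N := by
    intro b c hb hc
    have e : r + (b / N, c / N) = ((η.1.val + b) / N, (η.2.val + c) / N) := by
      simp [hr, add_div]
    have h1 := hL (r + (b / N, c / N)) r
    rw [add_sub_cancel_left, e] at h1
    have h2 := ContinuousLinearMap.le_opNorm
      (fderiv ℝ v ((η.1.val + b) / N, (η.2.val + c) / N) - fderiv ℝ v r) (1, 0)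
    have h3 : ‖((1, 0) : ℝ × ℝ)‖ = 1 := by simp [Prod.norm_def]
    rw [h3, mul_one, _root_.sub_apply, Real.norm_eq_abs, ← hA] at h2
    refine ⟨(fderiv ℝ v ((η.1.val + b) / N, (η.2.val + c) / N) (1, 0) - A) * N, ?_,
      by field_simp; ring⟩
    rw [abs_mul, abs_of_pos hN, ← le_div_iff₀ hN]
    refine (h2.trans h1).trans ?_
    calc M * ‖((b / N, c / N) : ℝ × ℝ)‖ ≤ M * (1 / N) :=
          mul_le_mul_of_nonneg_left (hnorm b c hb hc) hM
      _ = M / N := by ring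
  have n0 : |(0 : ℝ)| ≤ 1 := by simp
  have n1 : |(1 : ℝ)| ≤ 1 := by simp
  have nm : |(-1 : ℝ)| ≤ 1 := by simp
  obtain ⟨R00, b00, e00⟩ := hval 0 0 n0 n0
  obtain ⟨R10, b10, e10⟩ := hval 1 0 n1 n0
  obtain ⟨R01, b01, e01⟩ := hval 0 1 n0 n1
  obtain ⟨R11, b11, e11⟩ := hval 1 1 n1 n1
  obtain ⟨S00, s00, d00⟩ := hder 0 0 n0 n0
  obtain ⟨S10, s10, d10⟩ := hder 1 0 n1 n0
  obtain ⟨S01, s01, d01⟩ := hder 0 1 n0 n1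
  obtain ⟨S11, s11, d11⟩ := hder 1 1 n1 n1
  rw [abs_le] at b00 b10 b01 b11 s00 s10 s01 s11
  have hfin : ∀ Z : ℝ, truncation a N v η ξ = a * (Z / N) → |Z| ≤ 30 * M →
      |truncation a N v η ξ| ≤ 30 * a * M / N := by
    intro Z hZ hb
    rw [hZ, abs_mul, abs_div, abs_of_nonneg ha, abs_of_pos hN]
    calc a * (|Z| / N) ≤ a * (30 * M / N) := by gcongr
      _ = 30 * a * M / N := by ring
  simp only [truncation, Pi.add_apply, Matrix.mulVec, dotProduct, Fin.sum_univ_six,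
    Pih_left hv] at hfin ⊢
  simp only [Pih] at hfin ⊢
  simp only [add_zero] at e00 e10 e01 d00 d10 d01
  fin_cases ξ
  all_goals
    simp only [Lx00, Lxm, apt, Matrix.of_apply, Matrix.cons_val, Fin.isValue, Fin.zero_eta,
      Fin.mk_one, Fin.reduceFinMk, sub_add_cancel, add_zero, zero_mul, zero_add,
      e00, e10, e01, e11, d00, d10, d01, d11] at hfin ⊢
  · exact hfin (S00 - (3 * R00 + R10 + R01 - R01 - 4 * R00)) (by field_simp; ring)
      (abs_le.2 ⟨by linarith, by linarith⟩)
  · exact hfin (S10 - (-3 * R00 + R10 - 2 * R01 + 2 * R01 + 2 * R00)) (by field_simp; ring)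
      (abs_le.2 ⟨by linarith, by linarith⟩)
  · exact hfin (S01 - (R10 + 4 * R01 - 4 * R01 - R00)) (by field_simp; ring)
      (abs_le.2 ⟨by linarith, by linarith⟩)
  · exact hfin (S01 - (-R10 - 4 * R01 + 3 * R01 + R11 + R10)) (by field_simp; ring)
      (abs_le.2 ⟨by linarith, by linarith⟩)
  · exact hfin (S11 - (2 * R10 + 2 * R01 - 3 * R01 + R11 - 2 * R10)) (by field_simp; ring)
      (abs_le.2 ⟨by linarith, by linarith⟩)
  · exact hfin (S10 - (-4 * R10 - R01 + R11 + 4 * R10)) (by field_simp; ring)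
      (abs_le.2 ⟨by linarith, by linarith⟩)

lemma Periodic2.comp_sub {v : ℝ × ℝ → ℝ} (hv : Periodic2 v) (d : ℝ × ℝ) :
    Periodic2 (fun r => v (r - d)) := by
  constructor
  · intro x y
    change v (x + 1 - d.1, y - d.2) = v (x - d.1, y - d.2)
    rw [← hv.1 (x - d.1) (y - d.2), sub_add_eq_add_sub]
  · intro x y
    change v (x - d.1, y + 1 - d.2) = v (x - d.1, y - d.2)
    rw [← hv.2 (x - d.1) (y - d.2), sub_add_eq_add_sub]

/-- The error satisfies the scheme with the truncation error as the source. -/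
lemma IsSol.hasDerivAt_error {ω : ℝ × ℝ} (hy : ω.2 = 0) {N : ℕ} [NeZero N] {u : ℝ → Mesh N}
    (hu : IsSol ω N u) {v : ℝ × ℝ → ℝ} (hd : Differentiable ℝ v)
    (η : ZMod N × ZMod N) (t : ℝ) :
    HasDerivAt (fun s => (u s - Pih N (fun r => v (r - s • ω))) η)
      (truncation ω.1 N (fun r => v (r - t • ω)) η -
        (N * ω.1) • (Lx00 *ᵥ (u t - Pih N (fun r => v (r - t • ω))) η +
          Lxm *ᵥ (u t - Pih N (fun r => v (r - t • ω))) (η + (-1, 0)))) t := by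
  have hω : ω = ω.1 • ((1, 0) : ℝ × ℝ) := by ext <;> simp [hy]
  have hP : HasDerivAt (fun s => Pih N (fun r => v (r - s • ω)) η)
      (fun ξ => -(ω.1 * Pih N (fun r => fderiv ℝ (fun r => v (r - t • ω)) r (1, 0)) η ξ)) t := by
    rw [hasDerivAt_pi]
    intro ξ
    simp only [Pih, fderiv_comp_sub]
    set p : ℝ × ℝ := ((η.1.val + (apt ξ).1) / N, (η.2.val + (apt ξ).2) / N)
    have h1 : HasDerivAt (fun s : ℝ => p - s • ω) (-ω) t := by
      simpa using ((hasDerivAt_id t).smul_const ω).const_sub p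
    have h2 := (hd (p - t • ω)).hasFDerivAt.comp_hasDerivAt t h1
    refine h2.congr_deriv ?_
    rw [map_neg]
    nth_rewrite 2 [hω]
    rw [map_smul, smul_eq_mul]
  refine ((hu η t).sub hP).congr_deriv ?_
  have h00 : L00 ω = ω.1 • Lx00 := by simp [L00, hy]
  have h0m : L0m ω = 0 := by simp [L0m, hy]
  rw [h00, h0m, Lm0]
  ext ξ
  simp only [truncation, Pi.sub_apply, Matrix.mulVec_sub, Matrix.smul_mulVec, Matrix.zero_mulVec,
    Pi.smul_apply, Pi.add_apply, Pi.neg_apply, smul_eq_mul, Pi.zero_apply]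
  ring

/-- The total energy of a mesh function. -/
def meshEnergy (N : ℕ) [NeZero N] (w : Mesh N) : ℝ :=
  ∑ η : ZMod N × ZMod N, ((1 : ℝ) / N) ^ 2 * energyForm (w η) (w η)

lemma meshEnergy_nonneg (N : ℕ) [NeZero N] (w : Mesh N) : 0 ≤ meshEnergy N w :=
  Finset.sum_nonneg fun _ _ => mul_nonneg (by positivity) (energyForm_self_nonneg _)

lemma meshNorm_le_sqrt_meshEnergy (N : ℕ) [NeZero N] (w : Mesh N) :
    meshNorm N w ≤ √(meshEnergy N w) :=
  Real.sqrt_le_sqrt <| Finset.sum_le_sum fun _ _ =>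
    mul_le_mul_of_nonneg_left (sum_sq_le_energyForm _) (by positivity)

lemma sum_mesh_weight (N : ℕ) [NeZero N] (c : ℝ) :
    ∑ _η : ZMod N × ZMod N, ((1 : ℝ) / N) ^ 2 * c = c := by
  have hN : (N : ℝ) ≠ 0 := Nat.cast_ne_zero.2 (NeZero.ne N)
  simp [ZMod.card]
  field_simp

lemma sqrt_le_of_forall_deriv_le {E E' : ℝ → ℝ} {b d : ℝ} (hb : 0 < b) (hd : 0 < d)
    (hE0 : E 0 = 0) (hE : ∀ t, 0 ≤ E t) (hE' : ∀ t, HasDerivAt E (E' t) t)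
    (h : ∀ t a, 0 < a → E' t ≤ a * E t + a⁻¹ * b ^ 2) {t : ℝ} (ht : 0 ≤ t) :
    √(E t) ≤ d + b * t := by
  have hpos : ∀ s, 0 < E s + d ^ 2 := fun s => by have := hE s; positivity
  have hD : ∀ s, HasDerivAt (fun s => √(E s + d ^ 2) - b * s)
      (E' s / (2 * √(E s + d ^ 2)) - b * 1) s := fun s =>
    (((hE' s).add_const _).sqrt (hpos s).ne').sub ((hasDerivAt_id s).const_mul b)
  have hanti := antitone_of_hasDerivAt_nonpos hD fun s => by
    have hr : 0 < √(E s + d ^ 2) := Real.sqrt_pos.2 (hpos s)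
    have hsq := Real.sq_sqrt (hpos s).le
    set r := √(E s + d ^ 2)
    have h1 := h s (b / r) (by positivity)
    simp only [Pi.zero_apply]
    rw [mul_one, sub_nonpos, div_le_iff₀ (by positivity)]
    have h2 : b / r * E s ≤ b / r * r ^ 2 := by gcongr; nlinarith
    have h3 : b / r * r ^ 2 = b * r := by field_simp
    have h4 : (b / r)⁻¹ * b ^ 2 = b * r := by field_simp
    linarith
  have h1 := hanti ht
  simp only [hE0, zero_add, mul_zero, sub_zero, Real.sqrt_sq hd.le] at h1
  have h2 : √(E t) ≤ √(E t + d ^ 2) := Real.sqrt_le_sqrt (by nlinarith)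
  linarith

lemma hasOrder_one (ω : ℝ × ℝ) (hx : 0 < ω.1) (hy : ω.2 = 0) : HasOrder ω 1 := by
  intro v hv hc
  have hc2 : ContDiff ℝ 2 v := by exact_mod_cast hc
  have hd : Differentiable ℝ v := hc2.differentiable (by norm_num)
  obtain ⟨M, hM, hL⟩ := hv.exists_lipschitz_fderiv hc2
  set C : ℝ := 8 * (30 * ω.1 * M + 1)
  have hCpos : 0 < C := by positivity
  refine ⟨1, C, zero_le_one, hCpos.le, ?_⟩
  intro N _ u hu hu0 t ht
  have hN : (0 : ℝ) < N := Nat.cast_pos.2 (NeZero.pos N)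
  set w : ℝ → Mesh N := fun s => u s - Pih N (fun r => v (r - s • ω)) with hw
  set τ : ℝ → Mesh N := fun s => truncation ω.1 N (fun r => v (r - s • ω))
  have hτle : ∀ s η, energyForm (τ s η) (τ s η) ≤ (C / N) ^ 2 := by
    intro s η
    refine (energyForm_self_le (fun ξ => abs_truncation_le hx.le hM N (hv.comp_sub (s • ω))
      (hd.comp (differentiable_id.sub_const _)) ?_ η ξ)).trans ?_
    · intro p q
      rw [fderiv_comp_sub, fderiv_comp_sub]
      simpa using hL (p - s • ω) (q - s • ω)
    · rw [div_pow, div_pow, ← mul_div_assoc]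
      gcongr
      have : 0 ≤ 30 * ω.1 * M := by positivity
      nlinarith
  have hE' : ∀ s, HasDerivAt (fun s => meshEnergy N (w s))
      (∑ η, ((1 : ℝ) / N) ^ 2 * (2 * energyForm (w s η) (τ s η -
        (N * ω.1) • (Lx00 *ᵥ w s η + Lxm *ᵥ w s (η + (-1, 0)))))) s := fun s =>
    HasDerivAt.fun_sum fun η _ =>
      ((hu.hasDerivAt_error hy hd η s).energyForm_self).const_mul (((1 : ℝ) / N) ^ 2)
  have key := sqrt_le_of_forall_deriv_le (b := C / N) (d := 1 / N) (by positivity) (by positivity)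
    (by simp [meshEnergy, hw, hu0, energyForm]) (fun s => meshEnergy_nonneg N (w s)) hE' ?_ ht
  · refine ((meshNorm_le_sqrt_meshEnergy N _).trans key).trans (le_of_eq ?_)
    field_simp
  intro s a ha
  have hpt : ∀ η, ((1 : ℝ) / N) ^ 2 * (2 * energyForm (w s η) (τ s η -
      (N * ω.1) • (Lx00 *ᵥ w s η + Lxm *ᵥ w s (η + (-1, 0))))) ≤
      (((1 : ℝ) / N) ^ 2 * (a⁻¹ * (C / N) ^ 2)
        + a * (((1 : ℝ) / N) ^ 2 * energyForm (w s η) (w s η)))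
      + (((1 : ℝ) / N) ^ 2 * (N * ω.1) * energyFlux (w s (η + (-1, 0)))
        - ((1 : ℝ) / N) ^ 2 * (N * ω.1) * energyFlux (w s η)) := by
    intro η
    have e : ∀ x y z : Fin 6 → ℝ, ∀ k : ℝ,
        energyForm x (y - k • z) = energyForm x y - k * energyForm x z := by
      intro x y z k
      simp only [energyForm, Pi.sub_apply, Pi.smul_apply, smul_eq_mul]
      ring
    have h1 := energyFlux_sub_le (w s η) (w s (η + (-1, 0)))
    have h2 := two_mul_energyForm_le (w s η) (τ s η) ha
    have h3 := mul_le_mul_of_nonneg_left (hτle s η) (inv_pos.2 ha).le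
    have h4 := mul_le_mul_of_nonneg_left h1 (by positivity : 0 ≤ N * ω.1)
    rw [e]
    calc _ ≤ ((1 : ℝ) / N) ^ 2 * (a⁻¹ * (C / N) ^ 2 + a * energyForm (w s η) (w s η)
          + N * ω.1 * (energyFlux (w s (η + (-1, 0))) - energyFlux (w s η))) := by
          gcongr
          linarith
      _ = _ := by ring
  have hflux : ∑ η, ((1 : ℝ) / N) ^ 2 * (N * ω.1) * energyFlux (w s (η + (-1, 0))) =
      ∑ η, ((1 : ℝ) / N) ^ 2 * (N * ω.1) * energyFlux (w s η) :=
    Fintype.sum_equiv (Equiv.addRight ((-1, 0) : ZMod N × ZMod N)) _ _ fun _ => rfl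
  refine (Finset.sum_le_sum fun η _ => hpt η).trans (le_of_eq ?_)
  rw [Finset.sum_add_distrib, Finset.sum_add_distrib, Finset.sum_sub_distrib, sum_mesh_weight,
    ← Finset.mul_sum, hflux, sub_self, add_zero, meshEnergy]
  ring

section

open scoped Real

/-! ### Failure of second order -/

/-- A system of linear ODEs with constant coefficients is solvable. -/
lemma exists_hasDerivAt_mulVec {n : Type*} [Fintype n] [DecidableEq n] (B : Matrix n n ℂ)
    (x : n → ℂ) :
    ∃ U : ℝ → n → ℂ, U 0 = x ∧ ∀ t, HasDerivAt U (B *ᵥ U t) t := by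
  let T : (n → ℂ) →L[ℂ] (n → ℂ) := LinearMap.toContinuousLinearMap (Matrix.toLin' B)
  refine ⟨fun t => NormedSpace.exp (t • T) x, ?_, fun t => ?_⟩
  · have h0 : (0 : ℝ) • T = 0 := zero_smul ℝ T
    simp only [h0, NormedSpace.exp_zero, one_apply_eq_self]
  · exact ((ContinuousLinearMap.apply ℂ (n → ℂ) x).restrictScalars
      ℝ).hasFDerivAt.comp_hasDerivAt t (hasDerivAt_exp_smul_const' (𝕂 := ℝ) T t)

/-- The symbol of the scheme for the velocity `(1, 0)` at the multiplier `z` of a left shift. -/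
def symbolX (z : ℂ) : Matrix (Fin 6) (Fin 6) ℂ :=
  Lx00.map Complex.ofReal + z • Lxm.map Complex.ofReal

/-- The mesh function that is a Fourier mode in `x`, seen through a real functional on `ℂ`. -/
def modeMesh (φ : ℂ →L[ℝ] ℝ) (N : ℕ) (U : Fin 6 → ℂ) : Mesh N :=
  fun η ξ => φ (Complex.exp (2 * π * Complex.I * (η.1.val / N)) * U ξ)

/-- The wave `exp (2πi x)`, seen through a real functional on `ℂ`. -/
def wave (φ : ℂ →L[ℝ] ℝ) (p : ℝ × ℝ) : ℝ := φ (Complex.exp (2 * π * Complex.I * p.1))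

/-- The transported wave in the coordinates of a Fourier mode. -/
def waveVec (N : ℕ) (a : ℝ) : Fin 6 → ℂ :=
  fun ξ => Complex.exp (2 * π * Complex.I * ((apt ξ).1 / N - a))

lemma periodic2_wave (φ : ℂ →L[ℝ] ℝ) : Periodic2 (wave φ) := by
  refine ⟨fun x y => ?_, fun x y => rfl⟩
  simp only [wave]
  rw [← Complex.exp_periodic (2 * π * Complex.I * x)]
  push_cast
  congr 2
  ring

lemma contDiff_wave (φ : ℂ →L[ℝ] ℝ) (n : WithTop ℕ∞) : ContDiff ℝ n (wave φ) := by
  refine φ.contDiff.comp (ContDiff.cexp ?_)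
  exact contDiff_const.mul (Complex.ofRealCLM.contDiff.comp contDiff_fst)

lemma Pih_wave (φ : ℂ →L[ℝ] ℝ) (N : ℕ) [NeZero N] (ω : ℝ × ℝ) (t : ℝ) :
    Pih N (fun r => wave φ (r - t • ω)) = modeMesh φ N (waveVec N (t * ω.1)) := by
  funext η ξ
  simp only [Pih, wave, modeMesh, waveVec, ← Complex.exp_add, Prod.fst_sub, Prod.smul_fst,
    smul_eq_mul]
  push_cast
  congr 2
  ring

lemma modeMesh_left (φ : ℂ →L[ℝ] ℝ) (N : ℕ) [NeZero N] (U : Fin 6 → ℂ) (η : ZMod N × ZMod N) :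
    modeMesh φ N U (η + (-1, 0)) =
      modeMesh φ N (Complex.exp (-(2 * π * Complex.I / N)) • U) η := by
  obtain ⟨k, hk⟩ := ZMod.exists_val_sub_one N η.1
  have hk' : (((η.1 + -1).val : ℕ) : ℂ) = η.1.val - 1 + N * k := by exact_mod_cast hk
  have hN : (N : ℂ) ≠ 0 := Nat.cast_ne_zero.2 (NeZero.ne N)
  funext ξ
  simp only [modeMesh, Prod.fst_add, Pi.smul_apply, smul_eq_mul, hk', ← mul_assoc,
    ← Complex.exp_add]
  congr 2
  rw [Complex.exp_eq_exp_iff_exists_int]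
  refine ⟨k, ?_⟩
  field_simp
  ring

lemma modeMesh_mulVec (φ : ℂ →L[ℝ] ℝ) (N : ℕ) (B : Matrix (Fin 6) (Fin 6) ℝ) (U : Fin 6 → ℂ)
    (η : ZMod N × ZMod N) :
    modeMesh φ N (B.map Complex.ofReal *ᵥ U) η = B *ᵥ modeMesh φ N U η := by
  funext ξ
  simp only [modeMesh, Matrix.mulVec, dotProduct, Finset.mul_sum, map_sum, Matrix.map_apply]
  refine Finset.sum_congr rfl fun j _ => ?_
  rw [mul_left_comm, ← Complex.real_smul, map_smul, smul_eq_mul]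

lemma modeMesh_add (φ : ℂ →L[ℝ] ℝ) (N : ℕ) (U V : Fin 6 → ℂ) :
    modeMesh φ N (U + V) = modeMesh φ N U + modeMesh φ N V := by
  funext η ξ
  simp [modeMesh, mul_add]

lemma modeMesh_sub (φ : ℂ →L[ℝ] ℝ) (N : ℕ) (U V : Fin 6 → ℂ) :
    modeMesh φ N (U - V) = modeMesh φ N U - modeMesh φ N V := by
  funext η ξ
  simp [modeMesh, mul_sub]

lemma modeMesh_smul (φ : ℂ →L[ℝ] ℝ) (N : ℕ) (c : ℝ) (U : Fin 6 → ℂ) :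
    modeMesh φ N ((c : ℂ) • U) = c • modeMesh φ N U := by
  funext η ξ
  simp only [modeMesh, Pi.smul_apply, smul_eq_mul]
  rw [mul_left_comm, ← Complex.real_smul, map_smul, smul_eq_mul]

lemma isSol_modeMesh {ω : ℝ × ℝ} (hy : ω.2 = 0) (φ : ℂ →L[ℝ] ℝ) (N : ℕ) [NeZero N]
    {U : ℝ → Fin 6 → ℂ}
    (hU : ∀ t, HasDerivAt U
      (((-(N * ω.1) : ℝ) : ℂ) • (symbolX (Complex.exp (-(2 * π * Complex.I / N))) *ᵥ U t)) t) :
    IsSol ω N (fun t => modeMesh φ N (U t)) := by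
  intro η t
  have h : HasDerivAt (fun s => modeMesh φ N (U s) η) (modeMesh φ N
      (((-(N * ω.1) : ℝ) : ℂ) • (symbolX (Complex.exp (-(2 * π * Complex.I / N))) *ᵥ U t)) η) t := by
    rw [hasDerivAt_pi]
    intro ξ
    exact φ.hasFDerivAt.comp_hasDerivAt t ((hasDerivAt_pi.1 (hU t) ξ).const_mul _)
  refine h.congr_deriv ?_
  beta_reduce
  have h00 : L00 ω = ω.1 • Lx00 := by simp [L00, hy]
  have h0m : L0m ω = 0 := by simp [L0m, hy]
  rw [h00, h0m, Lm0, modeMesh_left, modeMesh_smul, symbolX, Matrix.add_mulVec, modeMesh_add,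
    Pi.smul_apply, Pi.add_apply, Matrix.smul_mulVec, ← Matrix.mulVec_smul,
    modeMesh_mulVec, modeMesh_mulVec, Matrix.zero_mulVec, Matrix.smul_mulVec, Matrix.smul_mulVec]
  module

lemma meshNorm_sq (N : ℕ) [NeZero N] (w : Mesh N) :
    meshNorm N w ^ 2 = ∑ η : ZMod N × ZMod N, ((1 : ℝ) / N) ^ 2 * ∑ ξ, w η ξ ^ 2 :=
  Real.sq_sqrt (Finset.sum_nonneg fun _ _ => by positivity)

lemma meshNorm_sq_re_add_im (N : ℕ) [NeZero N] (E : Fin 6 → ℂ) :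
    meshNorm N (modeMesh Complex.reCLM N E) ^ 2 + meshNorm N (modeMesh Complex.imCLM N E) ^ 2 =
      ∑ ξ, ‖E ξ‖ ^ 2 := by
  rw [meshNorm_sq, meshNorm_sq, ← Finset.sum_add_distrib, ← sum_mesh_weight N (∑ ξ, ‖E ξ‖ ^ 2)]
  refine Finset.sum_congr rfl fun η _ => ?_
  rw [← mul_add, ← Finset.sum_add_distrib]
  congr 1
  refine Finset.sum_congr rfl fun ξ _ => ?_
  have hn : ‖Complex.exp (2 * π * Complex.I * (η.1.val / N))‖ = 1 := by
    have e : (2 * π * Complex.I * (η.1.val / N) : ℂ) =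
        ((2 * π * (η.1.val / N) : ℝ) : ℂ) * Complex.I := by
      push_cast
      ring
    rw [e, Complex.norm_exp_ofReal_mul_I]
  rw [← one_mul ‖E ξ‖, ← hn, ← norm_mul, Complex.sq_norm, Complex.normSq_apply]
  simp only [modeMesh, Complex.reCLM_apply, Complex.imCLM_apply]
  ring

/-- The left null vector of the symbol at zero frequency coming from the alternation between
the two triangles of a block. -/
def altFunctional (U : Fin 6 → ℂ) : ℂ := 5 * U 0 + 5 * U 1 - U 2 - 5 * U 3 - 5 * U 4 + U 5

lemma altFunctional_symbolX (z : ℂ) (U : Fin 6 → ℂ) :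
    altFunctional (symbolX z *ᵥ U) = 9 * (z - 1) * (U 4 - U 5) := by
  simp [altFunctional, symbolX, Lx00, Lxm, dotProduct, Fin.sum_univ_six, Matrix.mulVec]
  ring

lemma HasDerivAt.altFunctional {U : ℝ → Fin 6 → ℂ} {U' : Fin 6 → ℂ} {t : ℝ}
    (h : HasDerivAt U U' t) : HasDerivAt (fun s => altFunctional (U s)) (altFunctional U') t := by
  have h := hasDerivAt_pi.1 h
  exact ((((((h 0).const_mul 5).add ((h 1).const_mul 5)).sub (h 2)).sub ((h 3).const_mul 5)).sub
    ((h 4).const_mul 5)).add (h 5)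

lemma norm_altFunctional_le {U : Fin 6 → ℂ} {B : ℝ} (hB : ∀ ξ, ‖U ξ‖ ≤ B) :
    ‖altFunctional U‖ ≤ 22 * B := by
  have h5 : ∀ ξ, ‖5 * U ξ‖ ≤ 5 * B := fun ξ => by
    rw [norm_mul, Complex.norm_ofNat]
    linarith [hB ξ]
  have := norm_add_le_of_le (norm_sub_le_of_le (norm_sub_le_of_le (norm_sub_le_of_le
    (norm_add_le_of_le (h5 0) (h5 1)) (hB 2)) (h5 3)) (h5 4)) (hB 5)
  unfold altFunctional
  linarith

lemma altFunctional_waveVec (N : ℕ) (a : ℝ) :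
    altFunctional (waveVec N a) =
      Complex.exp (-(2 * π * Complex.I * a)) * (Complex.exp (2 * π * Complex.I / N) - 1) := by
  have e : Complex.exp (2 * π * Complex.I * (1 / N - a)) =
      Complex.exp (-(2 * π * Complex.I * a)) * Complex.exp (2 * π * Complex.I / N) := by
    rw [← Complex.exp_add]
    congr 1
    ring
  simp only [altFunctional, waveVec, apt, Matrix.cons_val, Complex.ofReal_zero,
    Complex.ofReal_one, e, zero_div, zero_sub, mul_neg]
  ring

lemma waveVec_four_sub_five (N : ℕ) (a : ℝ) : waveVec N a 4 - waveVec N a 5 = 0 := by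
  simp [waveVec, apt]

lemma le_norm_exp_sub_one {N : ℕ} (hN : 4 ≤ N) :
    4 / (N : ℝ) ≤ ‖Complex.exp (2 * π * Complex.I / N) - 1‖ := by
  have hN' : (4 : ℝ) ≤ N := by exact_mod_cast hN
  have e : (2 * π * Complex.I / N : ℂ) = ((2 * π / N : ℝ) : ℂ) * Complex.I := by
    push_cast
    ring
  have h1 := Complex.abs_im_le_norm (Complex.exp (2 * π * Complex.I / N) - 1)
  rw [Complex.sub_im, Complex.one_im, sub_zero, e, Complex.exp_ofReal_mul_I_im, ← e] at h1
  have h2 : 2 * π / N ≤ π / 2 := by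
    rw [div_le_div_iff₀ (by linarith) (by norm_num)]
    nlinarith [Real.pi_pos]
  have h3 := Real.mul_le_sin (by positivity : 0 ≤ 2 * π / N) h2
  have h4 : 2 / π * (2 * π / N) = 4 / N := by
    field_simp
    norm_num
  linarith [le_abs_self (Real.sin (2 * π / N))]

lemma norm_exp_neg_sub_one_le (N : ℕ) :
    ‖Complex.exp (-(2 * π * Complex.I / N)) - 1‖ ≤ 2 * π / N := by
  have e : (-(2 * π * Complex.I / N) : ℂ) = Complex.I * ((-(2 * π / N) : ℝ) : ℂ) := by
    push_cast
    ring
  rw [e]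
  refine (Real.norm_exp_I_mul_ofReal_sub_one_le).trans (le_of_eq ?_)
  rw [norm_neg, Real.norm_of_nonneg (by positivity)]

/-- If the scheme were of second order, the Fourier mode `exp (2πi x)` would be approximated with
second order uniformly on bounded time intervals. -/
lemma HasOrder.exists_mode_error_le {ω : ℝ × ℝ} (h : HasOrder ω 2) (hy : ω.2 = 0) (T : ℝ) :
    ∃ K : ℝ, ∀ (N : ℕ) [NeZero N] (U : ℝ → Fin 6 → ℂ), U 0 = waveVec N 0 →
      (∀ t, HasDerivAt U
        (((-(N * ω.1) : ℝ) : ℂ) • (symbolX (Complex.exp (-(2 * π * Complex.I / N))) *ᵥ U t)) t) →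
      ∀ t ∈ Set.Icc 0 T, ∀ ξ, ‖U t ξ - waveVec N (t * ω.1) ξ‖ ≤ K * (1 / N) ^ 2 := by
  obtain ⟨c1, c2, hc1, hc2, hc⟩ := h (wave Complex.reCLM) (periodic2_wave _) (contDiff_wave _ _)
  obtain ⟨d1, d2, hd1, hd2, hd⟩ := h (wave Complex.imCLM) (periodic2_wave _) (contDiff_wave _ _)
  refine ⟨(c1 + c2 * T) + (d1 + d2 * T), fun N _ U hU0 hU t ht ξ => ?_⟩
  have hT : 0 ≤ T := ht.1.trans ht.2
  have hinit : ∀ φ : ℂ →L[ℝ] ℝ, modeMesh φ N (U 0) = Pih N (wave φ) := fun φ => by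
    have := Pih_wave φ N ω 0
    simp only [zero_smul, sub_zero, zero_mul] at this
    rw [hU0, this]
  have h1 := hc N _ (isSol_modeMesh hy Complex.reCLM N hU) (hinit _) t ht.1
  have h2 := hd N _ (isSol_modeMesh hy Complex.imCLM N hU) (hinit _) t ht.1
  rw [Pih_wave, ← modeMesh_sub] at h1 h2
  have h1' : (c1 + c2 * t) * ((1 : ℝ) / N) ^ 2 ≤ (c1 + c2 * T) * (1 / N) ^ 2 := by
    gcongr; exact ht.2
  have h2' : (d1 + d2 * t) * ((1 : ℝ) / N) ^ 2 ≤ (d1 + d2 * T) * (1 / N) ^ 2 := by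
    gcongr; exact ht.2
  have n1 : 0 ≤ meshNorm N (modeMesh Complex.reCLM N (U t - waveVec N (t * ω.1))) :=
    Real.sqrt_nonneg _
  have n2 : 0 ≤ meshNorm N (modeMesh Complex.imCLM N (U t - waveVec N (t * ω.1))) :=
    Real.sqrt_nonneg _
  have h3 := meshNorm_sq_re_add_im N (U t - waveVec N (t * ω.1))
  have h4 := Finset.single_le_sum (f := fun ξ => ‖(U t - waveVec N (t * ω.1)) ξ‖ ^ 2)
    (fun i _ => by positivity) (Finset.mem_univ ξ)
  simp only [← h3] at h4
  refine (abs_le_of_sq_le_sq' (h4.trans ?_) (by positivity)).2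
  rw [add_mul]
  nlinarith [mul_nonneg n1 n2]

lemma not_hasOrder_two (ω : ℝ × ℝ) (hx : 0 < ω.1) (hy : ω.2 = 0) : ¬ HasOrder ω 2 := by
  intro h
  set T : ℝ := 1 / (2 * ω.1) with hT
  have hTpos : 0 < T := by positivity
  have hTω : T * ω.1 = 1 / 2 := by rw [hT]; field_simp
  obtain ⟨K, hK⟩ := h.exists_mode_error_le hy T
  have main : ∀ N : ℕ, 4 ≤ N → (N : ℝ) ≤ (22 + 18 * π) * K / 8 := by
    intro N hN
    have : NeZero N := ⟨by omega⟩
    have hNpos : (0 : ℝ) < N := Nat.cast_pos.2 (NeZero.pos N)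
    set z := Complex.exp (-(2 * π * Complex.I / N))
    obtain ⟨U, hU0, hU⟩ := exists_hasDerivAt_mulVec (((-(N * ω.1) : ℝ) : ℂ) • symbolX z)
      (waveVec N 0)
    simp only [Matrix.smul_mulVec] at hU
    have hE := hK N U hU0 hU
    set R : ℝ := K * (1 / N) ^ 2 with hR
    have hderiv : ∀ t ∈ Set.Icc 0 T,
        ‖altFunctional (((-(N * ω.1) : ℝ) : ℂ) • (symbolX z *ᵥ U t))‖ ≤ 36 * π * ω.1 * R := by
      intro t ht
      have e : altFunctional (((-(N * ω.1) : ℝ) : ℂ) • (symbolX z *ᵥ U t)) =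
          ((-(N * ω.1) : ℝ) : ℂ) * (9 * (z - 1) * ((U t 4 - waveVec N (t * ω.1) 4)
            - (U t 5 - waveVec N (t * ω.1) 5))) := by
        have h1 := altFunctional_symbolX z (U t)
        have h2 := waveVec_four_sub_five N (t * ω.1)
        rw [sub_sub_sub_comm, h2, sub_zero, ← h1]
        simp only [altFunctional, Pi.smul_apply, smul_eq_mul]
        ring
      have h3 := norm_sub_le_of_le (hE t ht 4) (hE t ht 5)
      rw [e, norm_mul, norm_mul, norm_mul, Complex.norm_real, Real.norm_eq_abs, abs_neg,
        abs_of_pos (by positivity), Complex.norm_ofNat]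
      calc _ ≤ N * ω.1 * (9 * (2 * π / N) * (R + R)) := by
            gcongr
            exact norm_exp_neg_sub_one_le N
        _ = _ := by field_simp; ring
    have hmvt := (convex_Icc 0 T).norm_image_sub_le_of_norm_hasDerivWithin_le
      (fun t _ => ((hU t).altFunctional).hasDerivWithinAt) hderiv
      (Set.left_mem_Icc.2 hTpos.le) (Set.right_mem_Icc.2 hTpos.le)
    have hend := norm_altFunctional_le (hE T (Set.right_mem_Icc.2 hTpos.le))
    have hsplit : altFunctional (fun ξ => U T ξ - waveVec N (T * ω.1) ξ)
        - (altFunctional (U T) - altFunctional (U 0)) =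
        2 * (Complex.exp (2 * π * Complex.I / N) - 1) := by
      have e1 : altFunctional (fun ξ => U T ξ - waveVec N (T * ω.1) ξ) =
          altFunctional (U T) - altFunctional (waveVec N (T * ω.1)) := by
        simp only [altFunctional]
        ring
      have e2 : Complex.exp (-(2 * π * Complex.I * ((1 / 2 : ℝ) : ℂ))) = -1 := by
        rw [← Complex.exp_neg_pi_mul_I]
        congr 1
        push_cast
        ring
      rw [e1, hU0, altFunctional_waveVec, altFunctional_waveVec, hTω, e2]
      simp
      ring
    have hle := norm_sub_le_of_le hend hmvt
    rw [hsplit, norm_mul, Complex.norm_ofNat] at hle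
    have hlow := le_norm_exp_sub_one hN
    rw [sub_zero, Real.norm_of_nonneg hTpos.le] at hle
    have h8 : 8 / (N : ℝ) ≤ (22 + 18 * π) * R := by
      calc 8 / (N : ℝ) = 2 * (4 / N) := by ring
        _ ≤ 22 * R + 36 * π * ω.1 * R * T := by linarith
        _ = 22 * R + 36 * π * R * (T * ω.1) := by ring
        _ = _ := by rw [hTω]; ring
    rw [hR] at h8
    have h9 := mul_le_mul_of_nonneg_right h8 (by positivity : (0 : ℝ) ≤ N ^ 2)
    have h10 : 8 / (N : ℝ) * N ^ 2 = 8 * N := by field_simp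
    have h11 : (22 + 18 * π) * (K * (1 / (N : ℝ)) ^ 2) * N ^ 2 = (22 + 18 * π) * K := by
      field_simp
    linarith
  obtain ⟨n, hn⟩ := exists_nat_gt ((22 + 18 * π) * K / 8)
  have h1 := main (n + 4) (by omega)
  push_cast at h1
  linarith

end

/-- For `ω_x > ω_y = 0` (velocity parallel to a family of mesh edges)
the optimal order of accuracy of the SD-RT(1) scheme is 1: it has order 1 but not order 2. -/
theorem sdrt1_optimal_order_one_of_edge_parallel_velocity (ω : ℝ × ℝ)
    (hx : 0 < ω.1) (hy : ω.2 = 0) :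
    HasOrder ω 1 ∧ ¬ HasOrder ω 2 := by
  exact ⟨hasOrder_one ω hx hy, not_hasOrder_two ω hx hy⟩

end
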